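/- Let F : D → [0,+∞] be upper semicontinuous and let 𝓕 be a family of nonnegative subharmonic functions u : D → [0,+∞) such that u(x) ≤ F(x) for all x ∈ D. If for some ε > 0 one has ∫_D (log⁺ F(x))^{n-1+ε} dm_n(x) < +∞, then w(x) := sup_{u ∈ 𝓕} u(x) is locally bounded above in D, and consequently its upper semicontinuous regularization w*(x) := limsup_{y→x} w(y) is subharmonic in D. -/

import Mathlib

open MeasureTheory Metric Filter Set ENNReal

noncomputable section

/-- The positive part of an extended real number, as an element of `ℝ≥0∞`. -/
def erealPos (x : EReal) : ℝ≥0∞ := if x = ⊤ then ⊤ else ENNReal.ofReal x.toReal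

/-- `ν_n`, the Lebesgue measure of the unit ball of `ℝⁿ`. -/
def nuBall (n : ℕ) : ℝ := (volume (Metric.ball (0 : EuclideanSpace ℝ (Fin n)) 1)).toReal

/-- The (upper) integral `∫_A u dm_n` of an `EReal`-valued function, defined as the
lintegral of the positive part minus the lintegral of the negative part (an `EReal`). -/
def erealIntegralOn {n : ℕ} (A : Set (EuclideanSpace ℝ (Fin n)))
    (u : EuclideanSpace ℝ (Fin n) → EReal) : EReal :=
  ((∫⁻ y in A, erealPos (u y) : ℝ≥0∞) : EReal) - ((∫⁻ y in A, erealPos (-(u y)) : ℝ≥0∞) : EReal)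

/-- `u⁺ ∈ L¹_loc(D)`: the positive part of `u` has finite integral over every
compact subset of `D`. -/
def PosPartLocInt {n : ℕ} (u : EuclideanSpace ℝ (Fin n) → EReal)
    (D : Set (EuclideanSpace ℝ (Fin n))) : Prop :=
  ∀ E ⊆ D, IsCompact E → ∫⁻ x in E, erealPos (u x) < ⊤

/-- `u : D → [-∞, +∞)` is subharmonic on `D`: upper semicontinuous on `D`, never `+∞` on `D`,
and satisfying the sub-mean-value inequality on every closed ball contained in `D`.
(The function `≡ -∞` satisfies this definition.) -/
def SubharmonicOn {n : ℕ} (u : EuclideanSpace ℝ (Fin n) → EReal)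
    (D : Set (EuclideanSpace ℝ (Fin n))) : Prop :=
  UpperSemicontinuousOn u D ∧ (∀ x ∈ D, u x < ⊤) ∧
  ∀ x r, 0 < r → closedBall x r ⊆ D →
    u x ≤ ((1 / (nuBall n * r ^ n) : ℝ) : EReal) * erealIntegralOn (ball x r) u

/-- `u : D → [-∞, +∞)` is nearly subharmonic on `D`. -/
def NearlySubharmonicOn {n : ℕ} (u : EuclideanSpace ℝ (Fin n) → EReal)
    (D : Set (EuclideanSpace ℝ (Fin n))) : Prop :=
  Measurable (D.restrict u) ∧ (∀ x ∈ D, u x < ⊤) ∧ PosPartLocInt u D ∧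
  ∀ x r, 0 < r → closedBall x r ⊆ D →
    u x ≤ ((1 / (nuBall n * r ^ n) : ℝ) : EReal) * erealIntegralOn (ball x r) u

/-- `u : D → [-∞, +∞)` is `K`-quasinearly subharmonic on `D`:
Lebesgue measurable, `u⁺ ∈ L¹_loc(D)`, and for every `M ≥ 0` the function
`u_M := max {u, -M} + M` satisfies the generalized sub-mean-value inequality with constant `K`
on every closed ball contained in `D`. -/
def QNSubharmonicOn {n : ℕ} (K : ℝ) (u : EuclideanSpace ℝ (Fin n) → EReal)
    (D : Set (EuclideanSpace ℝ (Fin n))) : Prop :=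
  Measurable (D.restrict u) ∧ (∀ x ∈ D, u x < ⊤) ∧ PosPartLocInt u D ∧
  ∀ M : ℝ, 0 ≤ M → ∀ x r, 0 < r → closedBall x r ⊆ D →
    erealPos ((u x ⊔ ((-M : ℝ) : EReal)) + ((M : ℝ) : EReal)) ≤
      ENNReal.ofReal (K / (nuBall n * r ^ n)) *
        ∫⁻ y in ball x r, erealPos ((u y ⊔ ((-M : ℝ) : EReal)) + ((M : ℝ) : EReal))

/-- `u : D → [-∞, +∞)` is `K`-quasinearly subharmonic n.s. (in the narrow sense) on `D`. -/
def QNSubharmonicNSOn {n : ℕ} (K : ℝ) (u : EuclideanSpace ℝ (Fin n) → EReal)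
    (D : Set (EuclideanSpace ℝ (Fin n))) : Prop :=
  Measurable (D.restrict u) ∧ (∀ x ∈ D, u x < ⊤) ∧ PosPartLocInt u D ∧
  ∀ x r, 0 < r → closedBall x r ⊆ D →
    u x ≤ ((K / (nuBall n * r ^ n) : ℝ) : EReal) * erealIntegralOn (ball x r) u

/-- `log⁺` on `[0, +∞]`. -/
def logPlusE (t : ℝ≥0∞) : ℝ≥0∞ := if t = ⊤ then ⊤ else ENNReal.ofReal (Real.log t.toReal)

lemma erealPos_coe (a : ℝ) : erealPos (a : EReal) = ENNReal.ofReal a := by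
  simp [erealPos]

lemma erealPos_of_nonpos {t : EReal} (ht : t ≤ 0) : erealPos t = 0 := by
  have h : t ≠ ⊤ := (ht.trans_lt EReal.zero_lt_top).ne
  rw [erealPos, if_neg h, ENNReal.ofReal_eq_zero]
  exact EReal.toReal_nonpos ht

lemma ofReal_le_erealPos {a : ℝ} {t : EReal} (h : (a : EReal) ≤ t) :
    ENNReal.ofReal a ≤ erealPos t := by
  rw [erealPos]
  split_ifs with ht
  · exact le_top
  · exact ENNReal.ofReal_le_ofReal (EReal.toReal_le_toReal h (EReal.coe_ne_bot a) ht)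

lemma volume_ball_eq (n : ℕ) (x : EuclideanSpace ℝ (Fin n)) {r : ℝ} (hr : 0 < r) :
    volume (ball x r) = ENNReal.ofReal (nuBall n * r ^ n) := by
  rw [Measure.addHaar_ball_of_pos volume x hr, nuBall, ENNReal.ofReal_mul ENNReal.toReal_nonneg,
    ENNReal.ofReal_toReal measure_ball_lt_top.ne, mul_comm]
  simp

lemma nuBall_pos (n : ℕ) : 0 < nuBall n :=
  ENNReal.toReal_pos (measure_ball_pos _ _ one_pos).ne' measure_ball_lt_top.ne

lemma SubharmonicOn.ofReal_mul_volume_le {n : ℕ} {D : Set (EuclideanSpace ℝ (Fin n))}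
    {u : EuclideanSpace ℝ (Fin n) → ℝ} (hu : SubharmonicOn (fun x => ((u x : ℝ) : EReal)) D)
    (hu0 : ∀ x ∈ D, 0 ≤ u x) {x : EuclideanSpace ℝ (Fin n)} {r : ℝ} (hr : 0 < r)
    (hD : closedBall x r ⊆ D) :
    ENNReal.ofReal (u x) * volume (ball x r) ≤ ∫⁻ y in ball x r, ENNReal.ofReal (u y) := by
  have h := hu.2.2 x r hr hD
  have hneg : ∫⁻ y in ball x r, erealPos (-((u y : ℝ) : EReal)) = 0 := by
    rw [setLIntegral_congr_fun (g := fun _ => 0) measurableSet_ball, lintegral_zero]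
    intro y hy
    exact erealPos_of_nonpos
      (EReal.neg_le_zero.2 (EReal.coe_nonneg.2 (hu0 y (hD (ball_subset_closedBall hy)))))
  have hc : 0 < nuBall n * r ^ n := mul_pos (nuBall_pos n) (pow_pos hr n)
  rw [erealIntegralOn, hneg] at h
  simp only [erealPos_coe] at h
  rw [volume_ball_eq n x hr]
  generalize (∫⁻ y in ball x r, ENNReal.ofReal (u y)) = I at h ⊢
  induction I with
  | top => exact le_top
  | coe I =>
    have hI : ((I : ℝ≥0∞) : EReal) = ((I : ℝ) : EReal) := rfl
    rw [EReal.coe_ennreal_zero, sub_zero, hI, ← EReal.coe_mul, EReal.coe_le_coe_iff,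
      div_mul_eq_mul_div, one_mul, le_div_iff₀ hc] at h
    rw [← ENNReal.ofReal_mul' hc.le, ← ENNReal.ofReal_coe_nnreal]
    exact ENNReal.ofReal_le_ofReal h

lemma SubharmonicOn.mul_volume_le {n : ℕ} {D : Set (EuclideanSpace ℝ (Fin n))}
    {u : EuclideanSpace ℝ (Fin n) → ℝ} (hu : SubharmonicOn (fun x => ((u x : ℝ) : EReal)) D)
    (hu0 : ∀ x ∈ D, 0 ≤ u x) {x : EuclideanSpace ℝ (Fin n)} {r : ℝ} (hr : 0 < r)
    (hD : closedBall x r ⊆ D) {V : Set (EuclideanSpace ℝ (Fin n))} (hV : MeasurableSet V)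
    {A B : ℝ} (hA0 : 0 ≤ A) (hB0 : 0 ≤ B) (hA : ∀ y ∈ ball x r, u y ≤ A)
    (hB : ∀ y ∈ ball x r \ V, u y ≤ B) :
    u x * volume.real (ball x r) ≤
      A * volume.real (ball x r ∩ V) + B * volume.real (ball x r \ V) := by
  have h := hu.ofReal_mul_volume_le hu0 hr hD
  rw [← lintegral_inter_add_sdiff _ (ball x r) hV] at h
  have h1 : ∫⁻ y in ball x r ∩ V, ENNReal.ofReal (u y) ≤
      ENNReal.ofReal A * volume (ball x r ∩ V) := by
    rw [← setLIntegral_const]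
    exact setLIntegral_mono' (measurableSet_ball.inter hV)
      fun y hy => ENNReal.ofReal_le_ofReal (hA y hy.1)
  have h2 : ∫⁻ y in ball x r \ V, ENNReal.ofReal (u y) ≤
      ENNReal.ofReal B * volume (ball x r \ V) := by
    rw [← setLIntegral_const]
    exact setLIntegral_mono' (measurableSet_ball.diff hV)
      fun y hy => ENNReal.ofReal_le_ofReal (hB y hy)
  have h3 := h.trans (add_le_add h1 h2)
  have f1 : volume (ball x r ∩ V) ≠ ⊤ := measure_ne_top_of_subset inter_subset_left
    measure_ball_lt_top.ne
  have f2 : volume (ball x r \ V) ≠ ⊤ := measure_ne_top_of_subset sdiff_subset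
    measure_ball_lt_top.ne
  have h4 := ENNReal.toReal_mono (by finiteness) h3
  rw [ENNReal.toReal_add (by finiteness) (by finiteness)] at h4
  simpa [ENNReal.toReal_mul, Measure.real, hA0, hB0, hu0 x (hD (mem_closedBall_self hr.le))] using h4

lemma SubharmonicOn.isOpen_sublevel {n : ℕ} {D : Set (EuclideanSpace ℝ (Fin n))}
    {u : EuclideanSpace ℝ (Fin n) → ℝ} (hu : SubharmonicOn (fun x => ((u x : ℝ) : EReal)) D)
    (hDo : IsOpen D) (c : ℝ) : IsOpen {x ∈ D | u x < c} := by
  rw [isOpen_iff_mem_nhds]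
  rintro x ⟨hx, hxc⟩
  have := hu.1 x hx c (EReal.coe_lt_coe_iff.2 hxc)
  rw [hDo.nhdsWithin_eq hx] at this
  filter_upwards [this, hDo.mem_nhds hx] with y hy hyD
  exact ⟨hyD, EReal.coe_lt_coe_iff.1 hy⟩

lemma SubharmonicOn.measurableSet_superlevel {n : ℕ} {D : Set (EuclideanSpace ℝ (Fin n))}
    {u : EuclideanSpace ℝ (Fin n) → ℝ} (hu : SubharmonicOn (fun x => ((u x : ℝ) : EReal)) D)
    (hDo : IsOpen D) (c : ℝ) : MeasurableSet {x ∈ D | c ≤ u x} := by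
  convert hDo.measurableSet.diff (hu.isOpen_sublevel hDo c).measurableSet using 1
  ext x
  simp +contextual

lemma SubharmonicOn.exists_forall_le {n : ℕ} {D : Set (EuclideanSpace ℝ (Fin n))}
    {u : EuclideanSpace ℝ (Fin n) → ℝ} (hu : SubharmonicOn (fun x => ((u x : ℝ) : EReal)) D)
    {K : Set (EuclideanSpace ℝ (Fin n))} (hK : IsCompact K) (hne : K.Nonempty) (hKD : K ⊆ D) :
    ∃ a ∈ K, ∀ y ∈ K, u y ≤ u a := by
  obtain ⟨a, ha, h⟩ := (hu.1.mono hKD).exists_isMaxOn hne hK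
  exact ⟨a, ha, fun y hy => EReal.coe_le_coe_iff.1 (h hy)⟩

lemma exists_mem_ball_dist_lt {E : Type*} [NormedAddCommGroup E] [InnerProductSpace ℝ E]
    [Nontrivial E] (x a : E) {r : ℝ} (hr : 0 < r) : ∃ b ∈ ball a r, dist a x < dist b x := by
  obtain ⟨w, hw⟩ := exists_norm_eq E (half_pos hr).le
  have h := parallelogram_law_with_norm ℝ (a - x) w
  by_contra! hcon
  have h1 := hcon (a + w) (by simp [hw, hr])
  have h2 := hcon (a - w) (by simp [hw, hr])
  simp only [dist_eq_norm] at h1 h2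
  rw [add_sub_right_comm] at h1
  rw [sub_right_comm] at h2
  have h3 := pow_le_pow_left₀ (norm_nonneg _) h1 2
  have h4 := pow_le_pow_left₀ (norm_nonneg _) h2 2
  rw [hw] at h
  nlinarith

/-- Maximum principle on balls. -/
lemma SubharmonicOn.exists_mem_sphere_le {n : ℕ} [NeZero n] {D : Set (EuclideanSpace ℝ (Fin n))}
    (hDo : IsOpen D)
    {u : EuclideanSpace ℝ (Fin n) → ℝ} (hu : SubharmonicOn (fun x => ((u x : ℝ) : EReal)) D)
    (hu0 : ∀ x ∈ D, 0 ≤ u x) {x z : EuclideanSpace ℝ (Fin n)} {s : ℝ}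
    (hD : closedBall x s ⊆ D) (hz : z ∈ closedBall x s) :
    ∃ y ∈ sphere x s, u z ≤ u y := by
  obtain ⟨m, hm, hmax⟩ := hu.exists_forall_le (isCompact_closedBall x s) ⟨z, hz⟩ hD
  set K := closedBall x s \ {y ∈ D | u y < u m} with hK
  have hKc : IsCompact K := (isCompact_closedBall x s).diff (hu.isOpen_sublevel hDo _)
  obtain ⟨a, ha, hamax⟩ := hKc.exists_isMaxOn ⟨m, hm, fun h => lt_irrefl _ h.2⟩
    (f := fun y => dist y x) (by fun_prop)
  have hma : u m ≤ u a := by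
    by_contra! h
    exact ha.2 ⟨hD ha.1, h⟩
  refine ⟨a, ?_, (hmax z hz).trans hma⟩
  rw [mem_sphere]
  by_contra hne
  have hlt : dist a x < s := lt_of_le_of_ne ha.1 hne
  have hsub : closedBall a (s - dist a x) ⊆ closedBall x s :=
    closedBall_subset_closedBall' (by linarith)
  obtain ⟨b, hb, hbx⟩ := exists_mem_ball_dist_lt x a (sub_pos.2 hlt)
  have hbs := hsub (ball_subset_closedBall hb)
  have hbK : b ∉ K := fun h => absurd (hamax h) (not_le.2 hbx)
  have hbm : u b < u m := by
    by_contra h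
    exact hbK ⟨hbs, fun h' => h h'.2⟩
  obtain ⟨c, hbc, hcm⟩ := exists_between hbm
  have hb0 := hu0 b (hD hbs)
  have hmean := hu.mul_volume_le hu0 (sub_pos.2 hlt) (hsub.trans hD)
    (hu.measurableSet_superlevel hDo c) (A := u m) (B := c) (by linarith) (by linarith)
    (fun y hy => hmax y (hsub (ball_subset_closedBall hy)))
    (fun y hy => by
      by_contra! h
      exact hy.2 ⟨hD (hsub (ball_subset_closedBall hy.1)), h.le⟩)
  have hsplit := measureReal_inter_add_sdiff (μ := volume) (s := ball a (s - dist a x))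
    (hu.measurableSet_superlevel hDo c)
  have hpos : 0 < volume.real (ball a (s - dist a x) \ {y ∈ D | c ≤ u y}) := by
    refine ENNReal.toReal_pos ?_ (measure_ne_top_of_subset sdiff_subset measure_ball_lt_top.ne)
    have : ball a (s - dist a x) ∩ {y ∈ D | u y < c} ⊆
        ball a (s - dist a x) \ {y ∈ D | c ≤ u y} :=
      fun y hy => ⟨hy.1, fun h => absurd hy.2.2 (not_lt.2 h.2)⟩
    exact ((isOpen_ball.inter (hu.isOpen_sublevel hDo c)).measure_pos volume
      ⟨b, hb, hD hbs, hbc⟩ |>.trans_le (measure_mono this)).ne'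
  rw [← hsplit] at hmean
  nlinarith [mul_le_mul_of_nonneg_right hma (measureReal_nonneg (μ := volume)
    (s := ball a (s - dist a x)))]

lemma SubharmonicOn.exists_two_mul_le_or_le_volume {n : ℕ}
    {D : Set (EuclideanSpace ℝ (Fin n))} (hDo : IsOpen D) {u : EuclideanSpace ℝ (Fin n) → ℝ}
    (hu : SubharmonicOn (fun x => ((u x : ℝ) : EReal)) D) (hu0 : ∀ x ∈ D, 0 ≤ u x)
    {x : EuclideanSpace ℝ (Fin n)} {h t : ℝ} (hh : 0 < h) (hD : closedBall x h ⊆ D) (ht : 0 < t)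
    (hx : t ≤ u x) :
    (∃ y ∈ ball x h, 2 * t ≤ u y) ∨
      nuBall n * h ^ n / 4 ≤ volume.real (ball x h ∩ {y ∈ D | t / 2 ≤ u y}) := by
  refine or_iff_not_imp_left.2 fun hno => ?_
  push Not at hno
  have hmean := hu.mul_volume_le hu0 hh hD (hu.measurableSet_superlevel hDo (t / 2))
    (A := 2 * t) (B := t / 2) (by positivity) (by positivity) (fun y hy => (hno y hy).le)
    (fun y hy => by
      by_contra! h
      exact hy.2 ⟨hD (ball_subset_closedBall hy.1), h.le⟩)
  have hvol : volume.real (ball x h) = nuBall n * h ^ n := by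
    rw [Measure.real, volume_ball_eq n x hh, ENNReal.toReal_ofReal]
    exact (mul_pos (nuBall_pos n) (pow_pos hh n)).le
  have hle : volume.real (ball x h \ {y ∈ D | t / 2 ≤ u y}) ≤ volume.real (ball x h) :=
    measureReal_mono sdiff_subset measure_ball_lt_top.ne
  have h1 := mul_le_mul_of_nonneg_right hx (measureReal_nonneg (μ := volume) (s := ball x h))
  have h2 := mul_le_mul_of_nonneg_left hle ht.le
  rw [← hvol]
  refine le_of_mul_le_mul_left ?_ ht
  linarith

lemma SubharmonicOn.exists_doublings_add_eq {n : ℕ} [NeZero n]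
    {D : Set (EuclideanSpace ℝ (Fin n))} (hDo : IsOpen D) {u : EuclideanSpace ℝ (Fin n) → ℝ}
    (hu : SubharmonicOn (fun x => ((u x : ℝ) : EReal)) D) (hu0 : ∀ x ∈ D, 0 ≤ u x)
    {x z : EuclideanSpace ℝ (Fin n)} {ρ h t : ℝ} (hh : 0 < h) (ht : 0 < t)
    (hz : z ∈ closedBall x ρ) (hzt : t ≤ u z) (i : ℕ)
    (hD : closedBall x (ρ + 2 * i * h) ⊆ D) :
    ∃ a b : ℕ, a + b = i ∧ (∃ y ∈ closedBall x (ρ + 2 * i * h), 2 ^ a * t ≤ u y) ∧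
      b * (nuBall n * h ^ n / 4) ≤
        volume.real (ball x (ρ + 2 * i * h - h) ∩ {y ∈ D | t / 2 ≤ u y}) := by
  induction i with
  | zero => exact ⟨0, 0, rfl, ⟨z, by simpa using hz, by simpa using hzt⟩, by simp⟩
  | succ i ih =>
    have hs : ρ + 2 * (i + 1 : ℕ) * h = ρ + 2 * i * h + 2 * h := by push_cast; ring
    rw [hs] at hD ⊢
    set s := ρ + 2 * i * h
    have hsD : closedBall x s ⊆ D := (closedBall_subset_closedBall (by linarith)).trans hD
    obtain ⟨a, b, hab, ⟨y, hy, hyt⟩, hb⟩ := ih hsD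
    obtain ⟨p, hp, hyp⟩ := hu.exists_mem_sphere_le hDo hu0 hsD hy
    rw [mem_sphere] at hp
    have hmono : volume.real (ball x (s - h) ∩ {y ∈ D | t / 2 ≤ u y}) ≤
        volume.real (ball x (s + 2 * h - h) ∩ {y ∈ D | t / 2 ≤ u y}) :=
      measureReal_mono (inter_subset_inter_left _ (ball_subset_ball (by linarith)))
        (measure_ne_top_of_subset inter_subset_left measure_ball_lt_top.ne)
    rcases hu.exists_two_mul_le_or_le_volume hDo hu0 hh (x := p) (t := 2 ^ a * t)
      ((closedBall_subset_closedBall' (by linarith)).trans hD) (by positivity)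
      (hyt.trans hyp) with ⟨q, hq, hqt⟩ | hvol
    · refine ⟨a + 1, b, by omega, ⟨q, ?_, ?_⟩, hb.trans hmono⟩
      · exact (ball_subset_closedBall.trans (closedBall_subset_closedBall' (by linarith))) hq
      · rw [pow_succ']; linarith
    · refine ⟨a, b + 1, by omega, ⟨y, closedBall_subset_closedBall (by linarith) hy, hyt⟩, ?_⟩
      have hsub : ball p h ∩ {y ∈ D | 2 ^ a * t / 2 ≤ u y} ⊆
          ball p h ∩ {y ∈ D | t / 2 ≤ u y} := by
        refine inter_subset_inter_right _ fun y hy => ⟨hy.1, le_trans ?_ hy.2⟩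
        have : (1 : ℝ) ≤ 2 ^ a := one_le_pow₀ one_le_two
        nlinarith
      have hdisj : Disjoint (ball x (s - h) ∩ {y ∈ D | t / 2 ≤ u y})
          (ball p h ∩ {y ∈ D | t / 2 ≤ u y}) :=
        (ball_disjoint_ball (by rw [dist_comm, hp]; linarith)).mono inter_subset_left
          inter_subset_left
      have hunion : ball x (s - h) ∩ {y ∈ D | t / 2 ≤ u y} ∪ ball p h ∩ {y ∈ D | t / 2 ≤ u y} ⊆
          ball x (s + 2 * h - h) ∩ {y ∈ D | t / 2 ≤ u y} := by
        rw [← union_inter_distrib_right]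
        exact inter_subset_inter_left _ (union_subset (ball_subset_ball (by linarith))
          (ball_subset_ball' (by linarith)))
      have hm2 : volume.real (ball p h ∩ {y ∈ D | 2 ^ a * t / 2 ≤ u y}) ≤
          volume.real (ball p h ∩ {y ∈ D | t / 2 ≤ u y}) :=
        measureReal_mono hsub
          (measure_ne_top_of_subset inter_subset_left measure_ball_lt_top.ne)
      have hm3 := measureReal_mono (μ := volume) hunion
        (measure_ne_top_of_subset inter_subset_left measure_ball_lt_top.ne)
      rw [measureReal_union hdisj (measurableSet_ball.inter (hu.measurableSet_superlevel hDo _))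
        (measure_ne_top_of_subset inter_subset_left measure_ball_lt_top.ne)
        (measure_ne_top_of_subset inter_subset_left measure_ball_lt_top.ne)] at hm3
      push_cast
      linarith

lemma SubharmonicOn.exists_two_pow_mul_le {n : ℕ} [NeZero n]
    {D : Set (EuclideanSpace ℝ (Fin n))} (hDo : IsOpen D) {u : EuclideanSpace ℝ (Fin n) → ℝ}
    (hu : SubharmonicOn (fun x => ((u x : ℝ) : EReal)) D) (hu0 : ∀ x ∈ D, 0 ≤ u x)
    {x z : EuclideanSpace ℝ (Fin n)} {ρ L t : ℝ} (hL : 0 < L) (ht : 0 < t)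
    (hz : z ∈ closedBall x ρ) (hzt : t ≤ u z) {N : ℕ} (hN : 0 < N)
    (hD : closedBall x (ρ + L) ⊆ D)
    (hvol : volume {y ∈ D | t / 2 ≤ u y} <
      ENNReal.ofReal (N * (nuBall n * (L / (4 * N)) ^ n / 4))) :
    ∃ y ∈ closedBall x (ρ + L), 2 ^ N * t ≤ u y := by
  have hN' : (0 : ℝ) < N := by exact_mod_cast hN
  have hh : 0 < L / (4 * N) := by positivity
  have hrad : ρ + 2 * (2 * N : ℕ) * (L / (4 * N)) = ρ + L := by
    push_cast
    field_simp
    ring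
  obtain ⟨a, b, hab, ⟨y, hy, hyt⟩, hb⟩ :=
    hu.exists_doublings_add_eq hDo hu0 hh ht hz hzt (2 * N) (hrad.symm ▸ hD)
  rw [hrad] at hy
  refine ⟨y, hy, le_trans ?_ hyt⟩
  gcongr
  · exact one_le_two
  by_contra! haN
  have hNb : (N : ℝ) ≤ b := by exact_mod_cast (by omega : N ≤ b)
  have hc : 0 ≤ nuBall n * (L / (4 * N)) ^ n / 4 := by
    have := nuBall_pos n
    positivity
  have h1 := (mul_le_mul_of_nonneg_right hNb hc).trans hb
  have h2 := ENNReal.ofReal_le_ofReal h1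
  rw [ofReal_measureReal (measure_ne_top_of_subset inter_subset_left measure_ball_lt_top.ne)] at h2
  exact absurd (h2.trans (measure_mono inter_subset_right)) (not_le.2 hvol)

/-- If the superlevel sets of `u` decay fast enough, `u` cannot be large at the centre of a ball
contained in `D`. -/
lemma SubharmonicOn.lt_two_pow_of_volume_lt {n : ℕ} [NeZero n]
    {D : Set (EuclideanSpace ℝ (Fin n))} (hDo : IsOpen D) {u : EuclideanSpace ℝ (Fin n) → ℝ}
    (hu : SubharmonicOn (fun x => ((u x : ℝ) : EReal)) D) (hu0 : ∀ x ∈ D, 0 ≤ u x)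
    {A q δ : ℝ} (hA : 0 < A) (hq0 : 0 < q) (hq1 : q < 1) {k₀ : ℕ}
    (hk₀ : A / (1 - q) * q ^ k₀ ≤ δ)
    (hvol : ∀ k ≥ k₀, volume {y ∈ D | 2 ^ (2 ^ k) / 2 ≤ u y} < ENNReal.ofReal
      ((2 ^ k : ℕ) * (nuBall n * (A * q ^ k / (4 * (2 ^ k : ℕ))) ^ n / 4)))
    {x : EuclideanSpace ℝ (Fin n)} (hD : closedBall x δ ⊆ D) :
    u x < 2 ^ (2 ^ k₀) := by
  by_contra! hx
  have hq : 0 < 1 - q := by linarith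
  have hT : 0 < A / (1 - q) := by positivity
  have key : ∀ k ≥ k₀, ∃ y ∈ closedBall x (δ - A / (1 - q) * q ^ k), 2 ^ (2 ^ k) ≤ u y := by
    intro k hk
    induction k, hk using Nat.le_induction with
    | base => exact ⟨x, mem_closedBall_self (by linarith), hx⟩
    | succ k hk ih =>
      obtain ⟨y, hy, hyu⟩ := ih
      have hr : δ - A / (1 - q) * q ^ (k + 1) = δ - A / (1 - q) * q ^ k + A * q ^ k := by
        field_simp
        ring
      rw [hr]
      obtain ⟨w, hw, hwu⟩ := hu.exists_two_pow_mul_le hDo hu0 (L := A * q ^ k) (by positivity)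
        (by positivity) hy hyu (N := 2 ^ k) (by positivity)
        ((closedBall_subset_closedBall (by rw [← hr, sub_le_self_iff]; positivity)).trans hD)
        (hvol k hk)
      refine ⟨w, hw, le_of_eq_of_le ?_ hwu⟩
      rw [← pow_add, pow_succ 2 k, mul_two]
  have hδ : 0 ≤ δ := le_trans (by positivity) hk₀
  obtain ⟨m, -, hm⟩ := hu.exists_forall_le (isCompact_closedBall x δ)
    ⟨x, mem_closedBall_self hδ⟩ hD
  obtain ⟨k, hk⟩ := pow_unbounded_of_one_lt (u m) one_lt_two
  obtain ⟨y, hy, hyu⟩ := key (max k k₀) (le_max_right _ _)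
  have h1 := hm y (closedBall_subset_closedBall (by rw [sub_le_self_iff]; positivity) hy)
  have h2 : (2 : ℝ) ^ k ≤ 2 ^ (2 ^ max k k₀) :=
    pow_le_pow_right₀ one_le_two ((le_max_left k k₀).trans Nat.lt_two_pow_self.le)
  linarith

lemma ofReal_log_le_logPlusE {a : ℝ} (ha : 0 < a) {t : ℝ≥0∞} (h : (a : EReal) ≤ (t : EReal)) :
    ENNReal.ofReal (Real.log a) ≤ logPlusE t := by
  rw [logPlusE]
  split_ifs with ht
  · exact le_top
  · rw [← EReal.coe_ennreal_toReal ht, EReal.coe_le_coe_iff] at h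
    exact ENNReal.ofReal_le_ofReal (Real.log_le_log ha h)

lemma SubharmonicOn.ofReal_log_rpow_mul_volume_le {n : ℕ}
    {D : Set (EuclideanSpace ℝ (Fin n))} (hDo : IsOpen D) {u : EuclideanSpace ℝ (Fin n) → ℝ}
    (hu : SubharmonicOn (fun x => ((u x : ℝ) : EReal)) D)
    {F : EuclideanSpace ℝ (Fin n) → ℝ≥0∞}
    (huF : ∀ x ∈ D, ((u x : ℝ) : EReal) ≤ ((F x : ℝ≥0∞) : EReal)) {p c : ℝ} (hp : 0 ≤ p)
    (hc : 0 < c) :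
    ENNReal.ofReal (Real.log c) ^ p * volume {y ∈ D | c ≤ u y} ≤
      ∫⁻ x in D, logPlusE (F x) ^ p := by
  rw [← setLIntegral_const]
  refine (setLIntegral_mono' (hu.measurableSet_superlevel hDo c) fun y hy => ?_).trans
    (lintegral_mono_set fun y hy => hy.1)
  gcongr
  exact ofReal_log_le_logPlusE hc ((EReal.coe_le_coe_iff.2 hy.2).trans (huF y hy.1))

lemma le_log_two_pow_div_two {k : ℕ} (hk : 1 ≤ k) :
    ((2 ^ k : ℕ) : ℝ) / 4 ≤ Real.log (2 ^ (2 ^ k) / 2) := by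
  rw [Real.log_div (by positivity) two_ne_zero, Real.log_pow]
  have h1 := Real.log_two_gt_d9
  have h2 : (2 : ℝ) ≤ (2 ^ k : ℕ) := by
    exact_mod_cast (Nat.pow_le_pow_right two_pos hk : 2 ^ 1 ≤ 2 ^ k)
  nlinarith

lemma exists_decay_parameters {n : ℕ} (hn : 1 ≤ n) {ν ε I : ℝ} (hν : 0 < ν) (hε : 0 < ε)
    (hI : 0 ≤ I) :
    ∃ A > 0, ∃ q, 0 < q ∧ q < 1 ∧ ∀ k : ℕ, I / (((2 ^ k : ℕ) : ℝ) / 4) ^ ((n : ℝ) - 1 + ε) <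
      (2 ^ k : ℕ) * (ν * (A * q ^ k / (4 * (2 ^ k : ℕ))) ^ n / 4) := by
  set p := (n : ℝ) - 1 + ε
  have hn0 : (n : ℝ) ≠ 0 := by positivity
  set B := I * 4 ^ p * 4 ^ (n + 1) / ν
  have hB : 0 ≤ B := by positivity
  refine ⟨B + 1, by positivity, 2 ^ (-(ε / n)), by positivity,
    Real.rpow_lt_one_of_one_lt_of_neg one_lt_two (by simp; positivity), fun k => ?_⟩
  set N : ℝ := ((2 ^ k : ℕ) : ℝ) with hNdef
  have hN : 0 < N := by positivity
  have hqn : (((2 : ℝ) ^ (-(ε / n))) ^ k) ^ n = (N ^ ε)⁻¹ := by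
    rw [← pow_mul, ← Real.rpow_natCast, ← Real.rpow_mul two_pos.le, hNdef, Nat.cast_pow,
      Nat.cast_two, ← Real.rpow_natCast, ← Real.rpow_mul two_pos.le, ← Real.rpow_neg two_pos.le]
    congr 1
    push_cast
    field_simp
  have hNp : N ^ p = N ^ n / N * N ^ ε := by
    rw [Real.rpow_add hN, Real.rpow_sub hN, Real.rpow_natCast, Real.rpow_one]
  have hX : 0 < N ^ ε := by positivity
  have hA : B < (B + 1) ^ n :=
    (lt_add_one B).trans_le (le_self_pow₀ (by linarith) (by omega))
  rw [Real.div_rpow hN.le (by norm_num), hNp, div_pow, mul_pow, mul_pow, hqn]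
  have e1 : I / (N ^ n / N * N ^ ε / 4 ^ p) = B * (N * ν / (N ^ n * N ^ ε * 4 ^ n * 4)) := by
    simp only [B]
    field_simp
    ring
  have e2 : N * (ν * ((B + 1) ^ n * (N ^ ε)⁻¹ / (4 ^ n * N ^ n)) / 4) =
      (B + 1) ^ n * (N * ν / (N ^ n * N ^ ε * 4 ^ n * 4)) := by
    field_simp
  rw [e1, e2]
  gcongr

lemma exists_locally_uniform_bound {n : ℕ} [NeZero n] {D : Set (EuclideanSpace ℝ (Fin n))}
    (hDo : IsOpen D) {F : EuclideanSpace ℝ (Fin n) → ℝ≥0∞}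
    {𝓕 : Set (EuclideanSpace ℝ (Fin n) → ℝ)}
    (h𝓕 : ∀ u ∈ 𝓕, (∀ x ∈ D, 0 ≤ u x) ∧
      SubharmonicOn (fun x => ((u x : ℝ) : EReal)) D ∧
      ∀ x ∈ D, ((u x : ℝ) : EReal) ≤ ((F x : ℝ≥0∞) : EReal))
    {ε : ℝ} (hε : 0 < ε)
    (hint : ∫⁻ x in D, logPlusE (F x) ^ ((n : ℝ) - 1 + ε) < ⊤)
    {x : EuclideanSpace ℝ (Fin n)} (hx : x ∈ D) :
    ∃ r > (0 : ℝ), ∃ C : ℝ, ∀ y ∈ closedBall x r, ∀ u ∈ 𝓕, u y ≤ C := by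
  obtain ⟨δ, hδ, hball⟩ := Metric.nhds_basis_closedBall.mem_iff.1 (hDo.mem_nhds hx)
  have hn1 : 1 ≤ n := NeZero.one_le
  have hp : 0 ≤ (n : ℝ) - 1 + ε := by
    have : (1 : ℝ) ≤ n := by exact_mod_cast hn1
    linarith
  obtain ⟨A, hA, q, hq0, hq1, hdecay⟩ := exists_decay_parameters hn1 (nuBall_pos n) hε
    (ENNReal.toReal_nonneg (a := ∫⁻ x in D, logPlusE (F x) ^ ((n : ℝ) - 1 + ε)))
  have hlim : Tendsto (fun k : ℕ => A / (1 - q) * q ^ k) atTop (nhds 0) := by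
    simpa using (tendsto_pow_atTop_nhds_zero_of_lt_one hq0.le hq1).const_mul (A / (1 - q))
  obtain ⟨k₀, hk₀, hk₀1⟩ :=
    ((hlim.eventually_le_const (half_pos hδ)).and (eventually_ge_atTop 1)).exists
  refine ⟨δ / 2, half_pos hδ, 2 ^ (2 ^ k₀), fun y hy u hu => ?_⟩
  obtain ⟨hu0, hus, huF⟩ := h𝓕 u hu
  refine (hus.lt_two_pow_of_volume_lt hDo hu0 hA hq0 hq1 hk₀ (fun k hk => ?_)
    ((closedBall_subset_closedBall' (by linarith [mem_closedBall.1 hy])).trans hball)).le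
  have hcheb := hus.ofReal_log_rpow_mul_volume_le hDo huF hp (c := 2 ^ (2 ^ k) / 2) (by positivity)
  have hN : (0 : ℝ) < ((2 ^ k : ℕ) : ℝ) / 4 := by positivity
  have hlog := ENNReal.ofReal_le_ofReal (le_log_two_pow_div_two (hk₀1.trans hk))
  have h1 : ENNReal.ofReal ((((2 ^ k : ℕ) : ℝ) / 4) ^ ((n : ℝ) - 1 + ε)) *
      volume {y ∈ D | 2 ^ (2 ^ k) / 2 ≤ u y} ≤
      ∫⁻ x in D, logPlusE (F x) ^ ((n : ℝ) - 1 + ε) := by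
    refine le_trans ?_ hcheb
    rw [← ENNReal.ofReal_rpow_of_pos hN]
    gcongr
  have hNp := Real.rpow_pos_of_pos hN ((n : ℝ) - 1 + ε)
  have h2 : volume {y ∈ D | 2 ^ (2 ^ k) / 2 ≤ u y} ≤ ENNReal.ofReal
      ((∫⁻ x in D, logPlusE (F x) ^ ((n : ℝ) - 1 + ε)).toReal /
        (((2 ^ k : ℕ) : ℝ) / 4) ^ ((n : ℝ) - 1 + ε)) := by
    rw [ENNReal.ofReal_div_of_pos hNp, ENNReal.ofReal_toReal hint.ne,
      ENNReal.le_div_iff_mul_le (.inl (ENNReal.ofReal_pos.2 hNp).ne') (.inl ENNReal.ofReal_ne_top),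
      mul_comm]
    exact h1
  refine h2.trans_lt ((ENNReal.ofReal_lt_ofReal_iff_of_nonneg (by positivity)).2 (hdecay k))

lemma upperSemicontinuousOn_limsup_nhdsWithin {α : Type*} [TopologicalSpace α] (D : Set α)
    (w : α → EReal) : UpperSemicontinuousOn (fun x => limsup w (nhdsWithin x D)) D := by
  intro x hx c hc
  obtain ⟨c', hc', hcc⟩ := exists_between hc
  have h := eventually_lt_of_limsup_lt hc'
  filter_upwards [eventually_eventually_nhdsWithin.2 h] with y hy
  exact (limsup_le_of_le (by isBoundedDefault) (hy.mono fun _ h => h.le)).trans_lt hcc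

lemma subharmonicOn_limsup_iSup {n : ℕ} {D : Set (EuclideanSpace ℝ (Fin n))}
    {𝓕 : Set (EuclideanSpace ℝ (Fin n) → ℝ)}
    (h𝓕 : ∀ u ∈ 𝓕, (∀ x ∈ D, 0 ≤ u x) ∧ SubharmonicOn (fun x => ((u x : ℝ) : EReal)) D)
    (hbdd : ∀ x ∈ D, ∃ r > (0 : ℝ), ∃ C : ℝ, ∀ y ∈ closedBall x r, ∀ u ∈ 𝓕, u y ≤ C) :
    SubharmonicOn
      (fun x => limsup (fun y => ⨆ u ∈ 𝓕, ((u y : ℝ) : EReal)) (nhdsWithin x D)) D := by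
  set w : EuclideanSpace ℝ (Fin n) → EReal := fun y => ⨆ u ∈ 𝓕, ((u y : ℝ) : EReal) with hw
  refine ⟨upperSemicontinuousOn_limsup_nhdsWithin D w, fun x hx => ?_, fun x r hr hD => ?_⟩
  · obtain ⟨r, hr, C, hC⟩ := hbdd x hx
    refine (limsup_le_of_le (by isBoundedDefault) ?_).trans_lt (EReal.coe_lt_top C)
    filter_upwards [mem_nhdsWithin_of_mem_nhds (closedBall_mem_nhds x hr)] with y hy
    exact iSup₂_le fun u hu => EReal.coe_le_coe_iff.2 (hC y hy u hu)
  rcases 𝓕.eq_empty_or_nonempty with rfl | ⟨v, hv⟩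
  · have hx : x ∈ D := hD (mem_closedBall_self hr.le)
    have : (nhdsWithin x D).NeBot := nhdsWithin_neBot_of_mem hx
    simp [hw]
  have hle : ∀ y ∈ D, ∀ u ∈ 𝓕, ((u y : ℝ) : EReal) ≤ limsup w (nhdsWithin y D) := by
    intro y hy u hu
    refine (le_iSup₂ (f := fun u (_ : u ∈ 𝓕) => ((u y : ℝ) : EReal)) u hu).trans ?_
    refine le_limsup_of_frequently_le ?_ (by isBoundedDefault)
    exact (frequently_pure (a := y) (p := fun z => w y ≤ w z) |>.2 le_rfl).filter_mono (pure_le_nhdsWithin hy)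
  have hneg : ∫⁻ y in ball x r, erealPos (-limsup w (nhdsWithin y D)) = 0 := by
    rw [setLIntegral_congr_fun (g := fun _ => 0) measurableSet_ball, lintegral_zero]
    intro y hy
    have hyD := hD (ball_subset_closedBall hy)
    have h0 : 0 ≤ limsup w (nhdsWithin y D) :=
      (EReal.coe_nonneg.2 ((h𝓕 v hv).1 y hyD)).trans (hle y hyD v hv)
    exact erealPos_of_nonpos (EReal.neg_le_zero.2 h0)
  have hmean : ∀ y ∈ ball x r, ∀ u ∈ 𝓕,
      ENNReal.ofReal (u y) * ENNReal.ofReal (nuBall n * (r - dist y x) ^ n) ≤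
        ∫⁻ z in ball x r, erealPos (limsup w (nhdsWithin z D)) := by
    intro y hy u hu
    have hd : 0 < r - dist y x := sub_pos.2 hy
    rw [← volume_ball_eq n y hd]
    refine ((h𝓕 u hu).2.ofReal_mul_volume_le (h𝓕 u hu).1 hd
      ((closedBall_subset_closedBall' (by linarith)).trans hD)).trans ?_
    refine (lintegral_mono_set (ball_subset_ball' (by linarith))).trans
      (setLIntegral_mono' measurableSet_ball fun z hz => ?_)
    exact ofReal_le_erealPos (hle z (hD (ball_subset_closedBall hz)) u hu)
  have hc : 0 < nuBall n * r ^ n := mul_pos (nuBall_pos n) (pow_pos hr n)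
  rw [erealIntegralOn, hneg, EReal.coe_ennreal_zero, sub_zero]
  generalize (∫⁻ z in ball x r, erealPos (limsup w (nhdsWithin z D))) = I at hmean ⊢
  induction I with
  | top =>
    rw [EReal.coe_ennreal_top, EReal.coe_mul_top_of_pos (by positivity)]
    exact le_top
  | coe I =>
    have hI : ((I : ℝ≥0∞) : EReal) = ((I : ℝ) : EReal) := rfl
    rw [hI, ← EReal.coe_mul, div_mul_eq_mul_div, one_mul]
    have hwle : ∀ y ∈ ball x r, w y ≤ ((I / (nuBall n * (r - dist y x) ^ n) : ℝ) : EReal) := by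
      refine fun y hy => iSup₂_le fun u hu => EReal.coe_le_coe_iff.2 ?_
      have hpos : 0 < nuBall n * (r - dist y x) ^ n :=
        mul_pos (nuBall_pos n) (pow_pos (sub_pos.2 hy) n)
      rw [le_div_iff₀ hpos]
      have h := hmean y hy u hu
      rwa [← ENNReal.ofReal_mul' hpos.le, ← ENNReal.ofReal_coe_nnreal,
        ENNReal.ofReal_le_ofReal_iff I.coe_nonneg] at h
    have htend : Tendsto (fun y => ((I / (nuBall n * (r - dist y x) ^ n) : ℝ) : EReal))
        (nhdsWithin x D) (nhds ((I / (nuBall n * r ^ n) : ℝ) : EReal)) := by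
      refine (continuous_coe_real_ereal.tendsto _).comp (tendsto_nhdsWithin_of_tendsto_nhds ?_)
      have hcont : ContinuousAt (fun y => (I : ℝ) / (nuBall n * (r - dist y x) ^ n)) x :=
        ContinuousAt.div (by fun_prop) (by fun_prop) (by simpa using hc.ne')
      simpa [ContinuousAt] using hcont
    have hx : x ∈ D := hD (mem_closedBall_self hr.le)
    have : (nhdsWithin x D).NeBot := nhdsWithin_neBot_of_mem hx
    rw [← htend.limsup_eq]
    refine limsup_le_limsup ?_
    filter_upwards [mem_nhdsWithin_of_mem_nhds (ball_mem_nhds x hr)] with y hy using hwle y hy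

theorem domar_theoremA
    (n : ℕ) (hn : 2 ≤ n)
    (D : Set (EuclideanSpace ℝ (Fin n))) (hDopen : IsOpen D) (hDconn : IsConnected D)
    (F : EuclideanSpace ℝ (Fin n) → ℝ≥0∞) (hF : UpperSemicontinuousOn F D)
    (𝓕 : Set (EuclideanSpace ℝ (Fin n) → ℝ))
    (h𝓕 : ∀ u ∈ 𝓕, (∀ x ∈ D, 0 ≤ u x) ∧
      SubharmonicOn (fun x => ((u x : ℝ) : EReal)) D ∧
      ∀ x ∈ D, ((u x : ℝ) : EReal) ≤ ((F x : ℝ≥0∞) : EReal))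
    (ε : ℝ) (hε : 0 < ε)
    (hint : ∫⁻ x in D, logPlusE (F x) ^ ((n : ℝ) - 1 + ε) < ⊤) :
    (∀ x ∈ D, ∃ r > (0 : ℝ), ∃ C : ℝ, ∀ y ∈ closedBall x r ∩ D, ∀ u ∈ 𝓕, u y ≤ C) ∧
    SubharmonicOn
      (fun x => Filter.limsup (fun y => ⨆ u ∈ 𝓕, ((u y : ℝ) : EReal)) (nhdsWithin x D)) D := by
  have : NeZero n := ⟨by omega⟩
  have hbdd : ∀ x ∈ D, ∃ r > (0 : ℝ), ∃ C : ℝ, ∀ y ∈ closedBall x r, ∀ u ∈ 𝓕, u y ≤ C :=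
    fun x hx => exists_locally_uniform_bound hDopen h𝓕 hε hint hx
  refine ⟨fun x hx => ?_, subharmonicOn_limsup_iSup
    (fun u hu => ⟨(h𝓕 u hu).1, (h𝓕 u hu).2.1⟩) hbdd⟩
  obtain ⟨r, hr, C, hC⟩ := hbdd x hx
  exact ⟨r, hr, C, fun y hy => hC y hy.1⟩
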